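/- Let W be a real vector space, let B be a symmetric bilinear form on W, let Δ ∈ W, and let ω : W → ℝ be a linear functional with ω(Δ) = 1. Assume the kernel of B, i.e. { w ∈ W : B(w, u) = 0 for all u ∈ W }, equals the linear span of {Δ}. Then for every real number c ≠ 0 the symmetric bilinear form B_c defined by B_c(u, v) := B(u, v) + c·ω(u)·ω(v) is non-degenerate: B_c(w, u) = 0 for all u implies w = 0. -/

import Mathlib

/-- If the kernel of a symmetric bilinear form `B` on `W` is exactly the span of `Δ`,
and `ω` is a linear functional with `ω Δ = 1`, then for every `c ≠ 0` the form
`B_c (u, v) := B u v + c * ω u * ω v` is non-degenerate. -/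
theorem modified_form_nondegenerate
    (W : Type*) [AddCommGroup W] [Module ℝ W]
    (B : W →ₗ[ℝ] W →ₗ[ℝ] ℝ)
    (hsymm : ∀ x y : W, B x y = B y x)
    (Δ : W) (ω : W →ₗ[ℝ] ℝ) (hω : ω Δ = 1)
    (hker : {w : W | ∀ u : W, B w u = 0} = (Submodule.span ℝ {Δ} : Submodule ℝ W)) :
    ∀ c : ℝ, c ≠ 0 →
      ∀ w : W, (∀ u : W, B w u + c * ω w * ω u = 0) → w = 0 := by
  intro c hc w hw
  have hΔ : ∀ u : W, B Δ u = 0 :=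
    hker.symm.subset (Submodule.mem_span_singleton_self Δ)
  have hωw : ω w = 0 := by
    have h := hw Δ
    rw [hsymm w Δ, hΔ w, hω] at h
    simpa [hc] using h
  have hmem : w ∈ Submodule.span ℝ {Δ} :=
    hker.subset fun u => by simpa [hωw] using hw u
  obtain ⟨a, rfl⟩ := Submodule.mem_span_singleton.mp hmem
  have ha : a = 0 := by simpa [hω] using hωw
  rw [ha, zero_smul]
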